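/- arXiv:2309.06497 — 6 statements merged into one kernel-verified Lean document; each statement's English description precedes it below -/
import Mathlib

section
/- Let d be a positive integer, let (p_t)_{t≥0} be a sequence in ℝ^d, let (η_t)_{t≥0} be positive reals and (γ_t)_{t≥0} be positive reals, and set c_t = γ_t/(γ_t + 1) ∈ (0,1). Define the stochastic primal iterate averaging iteration by z_0 = w_0 ∈ ℝ^d, z_{t+1} = z_t - η_t p_t, and w_{t+1} = c_t w_t + (1 - c_t) z_{t+1}. Then w_1 = w_0 - (η_0/(γ_0+1)) p_0, and for every t ≥ 1 the iterates satisfy the heavy-ball recursion w_{t+1} = w_t - α_t p_t + δ_t (w_t - w_{t-1}) with α_t = η_t/(γ_t+1) = (1-c_t) η_t and δ_t = γ_{t-1}/(γ_t+1). -/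
/-- **Stochastic primal iterate averaging is a heavy-ball iteration.**
Averaging iteration: `z 0 = w 0`, `z (t+1) = z t - η t • p t`,
`w (t+1) = c t • w t + (1 - c t) • z (t+1)` with `c t = γ t / (γ t + 1) ∈ (0,1)`.
Then `w 1 = w 0 - (η 0 / (γ 0 + 1)) • p 0` and for every `t ≥ 1`,
`w (t+1) = w t - α t • p t + δ t • (w t - w (t-1))` with
`α t = η t / (γ t + 1) = (1 - c t) * η t` and `δ t = γ (t-1) / (γ t + 1)`. -/
theorem primal_averaging_eq_heavy_ball (d : ℕ) (hd : 0 < d)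
    (p z w : ℕ → Fin d → ℝ) (η γ : ℕ → ℝ)
    (hη : ∀ t, 0 < η t) (hγ : ∀ t, 0 < γ t)
    (c : ℕ → ℝ) (hc : ∀ t, c t = γ t / (γ t + 1))
    (hz0 : z 0 = w 0)
    (hz : ∀ t, z (t + 1) = z t - η t • p t)
    (hw : ∀ t, w (t + 1) = c t • w t + (1 - c t) • z (t + 1)) :
    (∀ t, c t ∈ Set.Ioo (0 : ℝ) 1) ∧
    w 1 = w 0 - (η 0 / (γ 0 + 1)) • p 0 ∧
    (∀ t, η t / (γ t + 1) = (1 - c t) * η t) ∧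
    (∀ t, w (t + 2) = w (t + 1) - (η (t + 1) / (γ (t + 1) + 1)) • p (t + 1)
      + (γ t / (γ (t + 1) + 1)) • (w (t + 1) - w t)) := by
  have hne : ∀ t, γ t + 1 ≠ 0 := fun t => (add_pos (hγ t) one_pos).ne'
  refine ⟨fun t => ?_, ?_, fun t => ?_, fun t => ?_⟩
  · have h := hγ t
    rw [hc, Set.mem_Ioo, div_lt_one (by linarith)]
    exact ⟨by positivity, by linarith⟩
  · have h0 := hne 0
    ext i
    rw [hw 0, hz 0, hz0, hc]
    simp only [Pi.add_apply, Pi.sub_apply, Pi.smul_apply, smul_eq_mul]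
    field_simp
    ring
  · have h := hne t
    rw [hc]
    field_simp
    ring
  · have h := hne t
    have h' := hne (t + 1)
    ext i
    rw [hw (t + 1), hz (t + 1), hw t, hc, hc]
    simp only [Pi.add_apply, Pi.sub_apply, Pi.smul_apply, smul_eq_mul]
    field_simp
    ring
end

section
/- Let d be a positive integer, let P : ℕ → ℝ^d → ℝ^d be a family of search-direction maps, let η > 0, c ∈ (0,1), and set α = (1-c)η and μ = c. Define the momentum iterates by m_0 = P(0, w_0), m_t = μ m_{t-1} + P(t, w_t) for t ≥ 1, w_{t+1} = w_t - α m_t, starting from w_0 ∈ ℝ^d; and define the averaging iterates by w'_0 = w_0, z_0 = w_0, z_{t+1} = z_t - η P(t, w'_t), w'_{t+1} = c w'_t + (1-c) z_{t+1}. Then w_t = w'_t for all t ≥ 0; i.e., the momentum method with constant hyperparameters α = (1-c)η and μ = c is equivalent to stochastic primal iterate averaging with constant hyperparameters η and c. -/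
/-- **Equivalence of momentum and stochastic primal iterate averaging with constant
hyperparameters.**  With `α = (1 - c) * η` and `μ = c`, the momentum iterates
`m 0 = P 0 w₀`, `m t = μ • m (t-1) + P t (w t)`, `w (t+1) = w t - α • m t`
coincide with the averaging iterates `z 0 = w₀`, `z (t+1) = z t - η • P t (w' t)`,
`w' (t+1) = c • w' t + (1 - c) • z (t+1)` started from the same point `w₀`. -/
theorem momentum_eq_primal_averaging (d : ℕ) (hd : 0 < d)
    (P : ℕ → (Fin d → ℝ) → (Fin d → ℝ))
    (η c : ℝ) (hη : 0 < η) (hc : c ∈ Set.Ioo (0 : ℝ) 1)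
    (α μ : ℝ) (hα : α = (1 - c) * η) (hμ : μ = c)
    (w₀ : Fin d → ℝ)
    (m w z w' : ℕ → Fin d → ℝ)
    (hw0 : w 0 = w₀)
    (hm0 : m 0 = P 0 w₀)
    (hm : ∀ t, m (t + 1) = μ • m t + P (t + 1) (w (t + 1)))
    (hw : ∀ t, w (t + 1) = w t - α • m t)
    (hw'0 : w' 0 = w₀) (hz0 : z 0 = w₀)
    (hz : ∀ t, z (t + 1) = z t - η • P t (w' t))
    (hw' : ∀ t, w' (t + 1) = c • w' t + (1 - c) • z (t + 1)) :
    ∀ t, w t = w' t := by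
  subst hα hμ
  have key : ∀ t, w t = w' t ∧ z (t + 1) = w t - η • m t := by
    intro t
    induction t with
    | zero => exact ⟨hw0.trans hw'0.symm, by rw [hz, hz0, hw'0, hw0, hm0]⟩
    | succ t ih =>
      obtain ⟨hww', hzt⟩ := ih
      have hnext : w (t + 1) = w' (t + 1) := by
        rw [hw, hw', hzt, ← hww']
        module
      refine ⟨hnext, ?_⟩
      rw [hz, ← hnext, hzt, hm]
      generalize P (t + 1) (w (t + 1)) = p
      rw [hw]
      module
  exact fun t => (key t).1
end

section
/- Let d be a positive integer, let (p_t)_{t≥0} be a sequence in ℝ^d, let (α_t)_{t≥0} and (μ_t)_{t≥0} be positive reals. Define the Nesterov accelerated iteration by m_0 = p_0, m_t = μ_{t-1} m_{t-1} + p_t for t ≥ 1, and w_{t+1} = w_t - α_t (μ_t m_t + p_t) for t ≥ 0, starting from some w_0 ∈ ℝ^d. Then for every t ≥ 1 the iterates satisfy the modified heavy-ball recursion w_{t+1} = w_t - α_t (p_t + μ_t (p_t - p_{t-1})) + δ_t (w_t - w_{t-1}) with δ_t = (α_t/α_{t-1}) μ_t. -/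
/-- **Nesterov acceleration is a modified heavy-ball iteration.**
Nesterov iteration: `m 0 = p 0`, `m t = μ (t-1) • m (t-1) + p t` for `t ≥ 1`,
`w (t+1) = w t - α t • (μ t • m t + p t)`.  Then for every `t ≥ 1`,
`w (t+1) = w t - α t • (p t + μ t • (p t - p (t-1))) + δ t • (w t - w (t-1))`
with `δ t = (α t / α (t-1)) * μ t`. -/
theorem nesterov_eq_modified_heavy_ball (d : ℕ) (hd : 0 < d)
    (p m w : ℕ → Fin d → ℝ) (α μ : ℕ → ℝ)
    (hα : ∀ t, 0 < α t) (hμ : ∀ t, 0 < μ t)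
    (hm0 : m 0 = p 0)
    (hm : ∀ t, m (t + 1) = μ t • m t + p (t + 1))
    (hw : ∀ t, w (t + 1) = w t - α t • (μ t • m t + p t)) :
    ∀ t, w (t + 2) = w (t + 1)
      - α (t + 1) • (p (t + 1) + μ (t + 1) • (p (t + 1) - p t))
      + ((α (t + 1) / α t) * μ (t + 1)) • (w (t + 1) - w t) := by
  intro t
  have h_ne : α t ≠ 0 := (hα t).ne'
  ext i
  rw [hw (t + 1), hm t, hw t]
  simp only [Pi.add_apply, Pi.sub_apply, Pi.smul_apply, smul_eq_mul]
  field_simp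
  ring
end

section
/- Let d be a positive integer, let (p_t)_{t≥0} be a sequence in ℝ^d with the convention p_{-1} = 0, let (η_t)_{t≥0}, (γ_t)_{t≥0}, (μ_t)_{t≥0} be positive reals, and set c_t = γ_t/(γ_t+1). Define the modified stochastic primal iterate averaging iteration by z_0 = w_0 ∈ ℝ^d, z_{t+1} = z_t - η_t (p_t + μ_t (p_t - p_{t-1})), and w_{t+1} = c_t w_t + (1-c_t) z_{t+1}. Then w_1 = w_0 - (η_0/(γ_0+1))(1+μ_0) p_0, and for every t ≥ 1 the iterates satisfy the modified heavy-ball recursion w_{t+1} = w_t - α_t (p_t + μ_t (p_t - p_{t-1})) + δ_t (w_t - w_{t-1}) with α_t = η_t/(γ_t+1) = (1-c_t)η_t and δ_t = γ_{t-1}/(γ_t+1). -/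
/-- **Modified stochastic primal iterate averaging is a modified heavy-ball iteration.**
With the convention `p (-1) = 0`, the iteration `z 0 = w 0`,
`z (t+1) = z t - η t • (p t + μ t • (p t - p (t-1)))`,
`w (t+1) = c t • w t + (1 - c t) • z (t+1)` with `c t = γ t / (γ t + 1)` satisfies
`w 1 = w 0 - (η 0 / (γ 0 + 1)) • ((1 + μ 0) • p 0)` and for every `t ≥ 1`,
`w (t+1) = w t - α t • (p t + μ t • (p t - p (t-1))) + δ t • (w t - w (t-1))` with
`α t = η t / (γ t + 1) = (1 - c t) * η t` and `δ t = γ (t-1) / (γ t + 1)`. -/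
theorem modified_primal_averaging_eq_modified_heavy_ball (d : ℕ) (hd : 0 < d)
    (p z w : ℕ → Fin d → ℝ) (η γ μ : ℕ → ℝ)
    (hη : ∀ t, 0 < η t) (hγ : ∀ t, 0 < γ t) (hμ : ∀ t, 0 < μ t)
    (c : ℕ → ℝ) (hc : ∀ t, c t = γ t / (γ t + 1))
    (hz0 : z 0 = w 0)
    (hz1 : z 1 = z 0 - η 0 • (p 0 + μ 0 • (p 0 - (0 : Fin d → ℝ))))
    (hz : ∀ t, z (t + 2) = z (t + 1)
        - η (t + 1) • (p (t + 1) + μ (t + 1) • (p (t + 1) - p t)))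
    (hw : ∀ t, w (t + 1) = c t • w t + (1 - c t) • z (t + 1)) :
    w 1 = w 0 - (η 0 / (γ 0 + 1)) • ((1 + μ 0) • p 0) ∧
    (∀ t, η t / (γ t + 1) = (1 - c t) * η t) ∧
    (∀ t, w (t + 2) = w (t + 1)
      - (η (t + 1) / (γ (t + 1) + 1)) • (p (t + 1) + μ (t + 1) • (p (t + 1) - p t))
      + (γ t / (γ (t + 1) + 1)) • (w (t + 1) - w t)) := by
  have hγ' : ∀ t, γ t + 1 ≠ 0 := fun t => by linarith [hγ t]
  have z_eq : ∀ t i, z (t + 1) i = (γ t + 1) * w (t + 1) i - γ t * w t i := by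
    intro t i
    have h := congrFun (hw t) i
    simp only [Pi.add_apply, Pi.smul_apply, smul_eq_mul, hc] at h
    have := hγ' t
    rw [h]
    field_simp
    ring
  refine ⟨?_, ?_, ?_⟩
  · ext i
    have h := congrFun hz1 i
    have h' := z_eq 0 i
    have := hγ' 0
    simp only [zero_add, hz0, Pi.add_apply, Pi.sub_apply, Pi.smul_apply, smul_eq_mul,
      Pi.zero_apply] at h h' ⊢
    field_simp
    linear_combination h - h'
  · intro t
    have := hγ' t
    rw [hc]
    field_simp
    ring
  · intro t
    ext i
    have h := congrFun (hz t) i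
    have h₀ := z_eq t i
    have h₁ := z_eq (t + 1) i
    have := hγ' (t + 1)
    simp only [Pi.add_apply, Pi.sub_apply, Pi.smul_apply, smul_eq_mul] at h ⊢
    field_simp
    linear_combination h + h₀ - h₁
end

section
/- Let d be a positive integer, let P : ℕ → ℝ^d → ℝ^d be a family of search-direction maps, let η > 0, c ∈ (0,1), and set α = (1-c)η and μ = c. Define the Nesterov accelerated iterates by m_0 = P(0, w_0), m_t = μ m_{t-1} + P(t, w_t) for t ≥ 1, w_{t+1} = w_t - α (μ m_t + P(t, w_t)), starting from w_0 ∈ ℝ^d; and define the modified averaging iterates by w'_0 = w_0, z_0 = w_0, z_{t+1} = z_t - η (q_t + μ (q_t - q_{t-1})) where q_t = P(t, w'_t) and q_{-1} = 0, and w'_{t+1} = c w'_t + (1-c) z_{t+1}. Then w_t = w'_t for all t ≥ 0; i.e., the Nesterov accelerated method with constant hyperparameters α = (1-c)η and μ = c is equivalent to the modified stochastic primal iterate averaging iteration with constant hyperparameters η, μ and c. -/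
/-- **Equivalence of Nesterov acceleration and modified stochastic primal iterate
averaging with constant hyperparameters.**  With `α = (1 - c) * η` and `μ = c`, the
Nesterov iterates `m 0 = P 0 w₀`, `m t = μ • m (t-1) + P t (w t)`,
`w (t+1) = w t - α • (μ • m t + P t (w t))` coincide with the modified averaging
iterates `z 0 = w₀`, `z (t+1) = z t - η • (q t + μ • (q t - q (t-1)))` where
`q t = P t (w' t)` and `q (-1) = 0`, and `w' (t+1) = c • w' t + (1 - c) • z (t+1)`,
started from the same point `w₀`. -/
theorem nesterov_eq_modified_primal_averaging (d : ℕ) (hd : 0 < d)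
    (P : ℕ → (Fin d → ℝ) → (Fin d → ℝ))
    (η c : ℝ) (hη : 0 < η) (hc : c ∈ Set.Ioo (0 : ℝ) 1)
    (α μ : ℝ) (hα : α = (1 - c) * η) (hμ : μ = c)
    (w₀ : Fin d → ℝ)
    (m w z w' : ℕ → Fin d → ℝ)
    (hw0 : w 0 = w₀)
    (hm0 : m 0 = P 0 w₀)
    (hm : ∀ t, m (t + 1) = μ • m t + P (t + 1) (w (t + 1)))
    (hw : ∀ t, w (t + 1) = w t - α • (μ • m t + P t (w t)))
    (hw'0 : w' 0 = w₀) (hz0 : z 0 = w₀)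
    (hz1 : z 1 = z 0 - η • (P 0 (w' 0) + μ • (P 0 (w' 0) - (0 : Fin d → ℝ))))
    (hz : ∀ t, z (t + 2) = z (t + 1)
        - η • (P (t + 1) (w' (t + 1)) + μ • (P (t + 1) (w' (t + 1)) - P t (w' t))))
    (hw' : ∀ t, w' (t + 1) = c • w' t + (1 - c) • z (t + 1)) :
    ∀ t, w t = w' t := by
  subst hα hμ
  suffices h : ∀ t, w t = w' t ∧ w (t + 1) = w' (t + 1) from fun t => (h t).1
  intro t
  induction t with
  | zero =>
    refine ⟨hw0.trans hw'0.symm, ?_⟩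
    rw [hw, hw', hz1, hm0, hz0, hw0, hw'0]
    module
  | succ t ih =>
    obtain ⟨h₀, h₁⟩ := ih
    refine ⟨h₁, ?_⟩
    have hstep := hw t
    have havg := hw' t
    rw [hw (t + 1), hw' (t + 1), hz t, hm t]
    rw [← h₁, ← h₀] at havg
    rw [← h₁, ← h₀]
    linear_combination (norm := module) havg - μ • hstep
end

section
/- Let m, n be positive integers, let r ∈ ℝ^m and c ∈ ℝ^n be vectors with strictly positive entries, and let G ∈ ℝ^{m×n}. Then the AdaFactor preconditioned direction equals a rescaled two-sided diagonal preconditioning of G: G / √(r c^T / (1_m^T r)) = √(1_m^T r) · diag(r)^{-1/2} G diag(c)^{-1/2}, where r c^T / (1_m^T r) ∈ ℝ^{m×n} is the rank-one matrix with entries r_i c_j / (Σ_i r_i), the division and square root on the left-hand side are entry-wise, and diag(r)^{-1/2}, diag(c)^{-1/2} are the diagonal matrices with entries r_i^{-1/2}, c_j^{-1/2} respectively. -/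
open Matrix

/-- **AdaFactor preconditioning as rescaled two-sided diagonal preconditioning.**
For positive row and column accumulators `r ∈ ℝ^m`, `c ∈ ℝ^n` and any `G ∈ ℝ^(m×n)`,
`G / √(r cᵀ / (1ₘᵀ r)) = √(1ₘᵀ r) • diag(r)^(-1/2) G diag(c)^(-1/2)`,
where division and square root on the left are entry-wise. -/
theorem adafactor_eq_rescaled_diagonal_shampoo (m n : ℕ) (hm : 0 < m) (hn : 0 < n)
    (r : Fin m → ℝ) (c : Fin n → ℝ)
    (hr : ∀ i, 0 < r i) (hc : ∀ j, 0 < c j)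
    (G : Matrix (Fin m) (Fin n) ℝ) :
    (Matrix.of fun i j => G i j / Real.sqrt (r i * c j / ∑ k, r k))
      = Real.sqrt (∑ k, r k) •
        (Matrix.diagonal (fun i => (Real.sqrt (r i))⁻¹) * G
          * Matrix.diagonal (fun j => (Real.sqrt (c j))⁻¹)) := by
  ext i j
  simp only [Matrix.of_apply, Matrix.smul_apply, Matrix.mul_diagonal, Matrix.diagonal_mul,
    smul_eq_mul]
  rw [Real.sqrt_div (mul_pos (hr i) (hc j)).le, Real.sqrt_mul (hr i).le, div_div_eq_mul_div,
    div_eq_mul_inv, mul_inv]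
  ring
end
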